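/- There exists a constant C > 0, depending only on p, such that for every t ≥ 0 the solution on ℝ^{1+2} satisfies the half-space weighted potential bound ∫_{ℝ²} 1_{{x₁ ≤ 0}} (t − x₁ + 1)^{(p−1)/2} |φ(t,x)|^{p+1} dx ≤ C · E_{0,2}. -/

import Mathlib

noncomputable section

open MeasureTheory Real Set Filter Pointwise

/-- The Euclidean plane. -/
abbrev E2 : Type := EuclideanSpace ℝ (Fin 2)

/-- Time derivative `∂ₜφ`. -/
def pt (φ : ℝ → E2 → ℝ) (t : ℝ) (x : E2) : ℝ := deriv (fun s => φ s x) t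

/-- Second time derivative `∂ₜ²φ`. -/
def ptt (φ : ℝ → E2 → ℝ) (t : ℝ) (x : E2) : ℝ := deriv (fun s => pt φ s x) t

/-- Spatial partial derivative `∂ᵢ f` in the `i`-th coordinate direction. -/
def pdx (i : Fin 2) (f : E2 → ℝ) (x : E2) : ℝ := fderiv ℝ f x (EuclideanSpace.single i 1)

/-- Spatial Laplacian `Δf`. -/
def lap (f : E2 → ℝ) (x : E2) : ℝ := ∑ i : Fin 2, pdx i (pdx i f) x

/-- Squared norm of the spatial gradient `|∇f|²`. -/
def gradSq (f : E2 → ℝ) (x : E2) : ℝ := ∑ i : Fin 2, (pdx i f x) ^ 2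

/-- Squared norm of the spatial Hessian `|∇²f|²`. -/
def hessSq (f : E2 → ℝ) (x : E2) : ℝ := ∑ i : Fin 2, ∑ j : Fin 2, (pdx i (pdx j f) x) ^ 2

/-- `φ` solves the defocusing wave equation `∂ₜ²φ - Δφ = -|φ|^{p-1}φ` on all of `ℝ × ℝ²`. -/
def IsWaveSolR2 (p : ℝ) (φ : ℝ → E2 → ℝ) : Prop :=
  ∀ t : ℝ, ∀ x : E2, ptt φ t x - lap (φ t) x = -(|φ t x| ^ (p-1) * φ t x)

/-- Integrand of the weighted (conformal) energy `E_{0,2}` of the data `(φ₀, φ₁)`. -/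
def e02Integrand (p : ℝ) (φ₀ φ₁ : E2 → ℝ) (x : E2) : ℝ :=
  (1+‖x‖)^2 * (gradSq φ₀ x + (φ₁ x)^2) + (1+‖x‖)^2 * |φ₀ x| ^ (p+1)

/-- The weighted energy `E_{0,2}` on the whole plane. -/
def E02R (p : ℝ) (φ₀ φ₁ : E2 → ℝ) : ℝ := ∫ x : E2, e02Integrand p φ₀ φ₁ x

/-- The point `(a, b)` of the Euclidean plane. -/
def mkE (a b : ℝ) : E2 := EuclideanSpace.single 0 a + EuclideanSpace.single 1 b

/-! ### A weight adapted to the null coordinate -/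

/-- The weight `(1 + u² + u√(1 + u²))^(-m)`: comparable to `(1 + u²)^(-m)` for `u ≥ 0`, and
bounded for `u ≤ 0`. -/
def nullWeight (m u : ℝ) : ℝ := (1 + u ^ 2 + u * √(1 + u ^ 2)) ^ (-m)

lemma abs_le_sqrt_one_add_sq (u : ℝ) : |u| ≤ √(1 + u ^ 2) :=
  Real.abs_le_sqrt (by linarith)

lemma one_half_le_nullWeight_base (u : ℝ) : 1 / 2 ≤ 1 + u ^ 2 + u * √(1 + u ^ 2) := by
  have h : √(1 + u ^ 2) ^ 2 = 1 + u ^ 2 := Real.sq_sqrt (by positivity)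
  nlinarith [sq_nonneg (u + √(1 + u ^ 2))]

lemma nullWeight_base_pos (u : ℝ) : 0 < 1 + u ^ 2 + u * √(1 + u ^ 2) := by
  linarith [one_half_le_nullWeight_base u]

lemma nullWeight_base_le (u : ℝ) : 1 + u ^ 2 + u * √(1 + u ^ 2) ≤ 2 * (1 + u ^ 2) := by
  have h : √(1 + u ^ 2) ^ 2 = 1 + u ^ 2 := Real.sq_sqrt (by positivity)
  nlinarith [sq_nonneg (u - √(1 + u ^ 2))]

lemma nullWeight_pos (m u : ℝ) : 0 < nullWeight m u :=
  Real.rpow_pos_of_pos (nullWeight_base_pos u) _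

lemma nullWeight_le_two {m : ℝ} (h0 : 0 ≤ m) (h1 : m ≤ 1) (u : ℝ) : nullWeight m u ≤ 2 := by
  have h := Real.rpow_le_rpow_of_nonpos (by norm_num : (0 : ℝ) < 1 / 2)
    (one_half_le_nullWeight_base u) (by linarith : -m ≤ 0)
  refine h.trans ?_
  rw [one_div, Real.inv_rpow (by norm_num), Real.rpow_neg (by norm_num), inv_inv]
  simpa using Real.rpow_le_rpow_of_exponent_le (by norm_num : (1 : ℝ) ≤ 2) h1

lemma le_nullWeight {m : ℝ} (h0 : 0 ≤ m) (u : ℝ) :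
    (2 * (1 + u ^ 2)) ^ (-m) ≤ nullWeight m u :=
  Real.rpow_le_rpow_of_nonpos (nullWeight_base_pos u) (nullWeight_base_le u) (by linarith)

lemma contDiff_nullWeight (m : ℝ) : ContDiff ℝ 1 (nullWeight m) := by
  refine ContDiff.rpow_const_of_ne ?_ fun u => (nullWeight_base_pos u).ne'
  have h : ContDiff ℝ 1 fun u : ℝ => √(1 + u ^ 2) :=
    ContDiff.sqrt (by fun_prop) fun u => by positivity
  fun_prop

lemma hasDerivAt_nullWeight (m u : ℝ) :
    HasDerivAt (nullWeight m)
      (-m * ((u + √(1 + u ^ 2)) / (1 + u ^ 2)) * nullWeight m u) u := by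
  have hs : 0 < 1 + u ^ 2 := by positivity
  have hq : √(1 + u ^ 2) ^ 2 = 1 + u ^ 2 := Real.sq_sqrt hs.le
  have hq0 : 0 < √(1 + u ^ 2) := Real.sqrt_pos.2 hs
  have h1 : HasDerivAt (fun u : ℝ => 1 + u ^ 2) (2 * u) u := by
    simpa using (hasDerivAt_pow 2 u).const_add 1
  have h2 := h1.sqrt hs.ne'
  have h3 := (h1.add ((hasDerivAt_id u).mul h2)).rpow_const (p := -m)
    (Or.inl (nullWeight_base_pos u).ne')
  refine h3.congr_deriv ?_
  have hb := nullWeight_base_pos u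
  have h4 : (1 + u ^ 2 + u * √(1 + u ^ 2)) ^ (-m - 1)
      = nullWeight m u / (1 + u ^ 2 + u * √(1 + u ^ 2)) := by
    rw [nullWeight, Real.rpow_sub_one hb.ne']
  simp only [Pi.add_apply, Pi.mul_apply, id]
  rw [h4]
  have key : (2 * u + (1 * √(1 + u ^ 2) + u * (2 * u / (2 * √(1 + u ^ 2))))) * (1 + u ^ 2)
      = (u + √(1 + u ^ 2)) * (1 + u ^ 2 + u * √(1 + u ^ 2)) := by
    field_simp
    generalize √(1 + u ^ 2) = r at *
    linear_combination (-(u * r + u ^ 2)) * hq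
  rw [(div_eq_div_iff hs.ne' hb.ne').2 key.symm]
  ring

lemma deriv_nullWeight_nonpos {m : ℝ} (h0 : 0 ≤ m) (u : ℝ) : deriv (nullWeight m) u ≤ 0 := by
  rw [(hasDerivAt_nullWeight m u).deriv]
  have h1 := abs_le.1 (abs_le_sqrt_one_add_sq u)
  have : 0 ≤ (u + √(1 + u ^ 2)) / (1 + u ^ 2) := div_nonneg (by linarith) (by positivity)
  have := mul_nonneg (mul_nonneg h0 this) (nullWeight_pos m u).le
  linarith

lemma deriv_nullWeight_mul_le {m : ℝ} (h0 : 0 ≤ m) (u : ℝ) :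
    deriv (nullWeight m) u * (1 + u ^ 2) ≤ -(2 * m * u * nullWeight m u) := by
  rw [(hasDerivAt_nullWeight m u).deriv]
  have h1 := abs_le.1 (abs_le_sqrt_one_add_sq u)
  have h2 : -m * ((u + √(1 + u ^ 2)) / (1 + u ^ 2)) * nullWeight m u * (1 + u ^ 2)
      = -m * (u + √(1 + u ^ 2)) * nullWeight m u := by
    have : (1 + u ^ 2) ≠ 0 := by positivity
    field_simp
  rw [h2]
  have := mul_nonneg (mul_nonneg h0 (nullWeight_pos m u).le)
    (by linarith : 0 ≤ √(1 + u ^ 2) - u)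
  linarith

/-! ### The energy current of the weighted conformal multiplier -/

/-- Energy density: `f` is the weight, `u` and `y` the coordinates, `s`, `a`, `b`, `c` the values
of `φ`, `∂ₜφ`, `∂₁φ`, `∂₂φ`, and `P` the potential. -/
def curT (f u y s a b c P : ℝ) : ℝ :=
  f * ((y * (a + b) / 2 + u * c / 2) ^ 2 + (u * (a - b) / 2 + y * c / 2 + s / 2) ^ 2
    + (c / 2) ^ 2 + ((a - b) / 2) ^ 2 + (1 + u ^ 2 + y ^ 2) / 2 * P)

/-- First component of the energy flux. -/
def curX (f u y s a b c P : ℝ) : ℝ :=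
  f * ((y * (a + b) / 2 + u * c / 2) ^ 2 - (u * (a - b) / 2 + y * c / 2 + s / 2) ^ 2
    + (c / 2) ^ 2 - ((a - b) / 2) ^ 2 + (1 + u ^ 2 - y ^ 2) / 2 * P)

/-- Second component of the energy flux. -/
def curY (f u y s a b c P : ℝ) : ℝ :=
  f * (2 * (y * (a + b) / 2 + u * c / 2) * (u * (a - b) / 2 + y * c / 2 + s / 2)
    + 2 * (c / 2) * ((a - b) / 2) - u * y * P)

section Derivatives

variable {f u y s a b c P : ℝ → ℝ} {f' u' y' s' a' b' c' P' t : ℝ}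

lemma hasDerivAt_curT (hf : HasDerivAt f f' t) (hu : HasDerivAt u u' t) (hy : HasDerivAt y y' t)
    (hs : HasDerivAt s s' t) (ha : HasDerivAt a a' t) (hb : HasDerivAt b b' t)
    (hc : HasDerivAt c c' t) (hP : HasDerivAt P P' t) :
    HasDerivAt (fun r => curT (f r) (u r) (y r) (s r) (a r) (b r) (c r) (P r))
      (f' * ((y t * (a t + b t) / 2 + u t * c t / 2) ^ 2
          + (u t * (a t - b t) / 2 + y t * c t / 2 + s t / 2) ^ 2
          + (c t / 2) ^ 2 + ((a t - b t) / 2) ^ 2 + (1 + u t ^ 2 + y t ^ 2) / 2 * P t)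
        + f t * (2 * (y t * (a t + b t) / 2 + u t * c t / 2)
            * ((y' * (a t + b t) + y t * (a' + b') + u' * c t + u t * c') / 2)
          + 2 * (u t * (a t - b t) / 2 + y t * c t / 2 + s t / 2)
            * ((u' * (a t - b t) + u t * (a' - b') + y' * c t + y t * c' + s') / 2)
          + c t * c' / 2 + (a t - b t) * (a' - b') / 2
          + (u t * u' + y t * y') * P t + (1 + u t ^ 2 + y t ^ 2) / 2 * P')) t := by
  have hA := ((hy.mul (ha.add hb)).div_const 2).add ((hu.mul hc).div_const 2)
  have hB := (((hu.mul (ha.sub hb)).div_const 2).add ((hy.mul hc).div_const 2)).add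
    (hs.div_const 2)
  have h := hf.mul (((((hA.pow 2).add (hB.pow 2)).add ((hc.div_const 2).pow 2)).add
    (((ha.sub hb).div_const 2).pow 2)).add
    (((((hu.pow 2).const_add 1).add (hy.pow 2)).div_const 2).mul hP))
  refine h.congr_deriv ?_
  simp only [Pi.add_apply, Pi.mul_apply, Pi.sub_apply, Pi.pow_apply]
  push_cast
  ring

lemma hasDerivAt_curX (hf : HasDerivAt f f' t) (hu : HasDerivAt u u' t) (hy : HasDerivAt y y' t)
    (hs : HasDerivAt s s' t) (ha : HasDerivAt a a' t) (hb : HasDerivAt b b' t)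
    (hc : HasDerivAt c c' t) (hP : HasDerivAt P P' t) :
    HasDerivAt (fun r => curX (f r) (u r) (y r) (s r) (a r) (b r) (c r) (P r))
      (f' * ((y t * (a t + b t) / 2 + u t * c t / 2) ^ 2
          - (u t * (a t - b t) / 2 + y t * c t / 2 + s t / 2) ^ 2
          + (c t / 2) ^ 2 - ((a t - b t) / 2) ^ 2 + (1 + u t ^ 2 - y t ^ 2) / 2 * P t)
        + f t * (2 * (y t * (a t + b t) / 2 + u t * c t / 2)
            * ((y' * (a t + b t) + y t * (a' + b') + u' * c t + u t * c') / 2)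
          - 2 * (u t * (a t - b t) / 2 + y t * c t / 2 + s t / 2)
            * ((u' * (a t - b t) + u t * (a' - b') + y' * c t + y t * c' + s') / 2)
          + c t * c' / 2 - (a t - b t) * (a' - b') / 2
          + (u t * u' - y t * y') * P t + (1 + u t ^ 2 - y t ^ 2) / 2 * P')) t := by
  have hA := ((hy.mul (ha.add hb)).div_const 2).add ((hu.mul hc).div_const 2)
  have hB := (((hu.mul (ha.sub hb)).div_const 2).add ((hy.mul hc).div_const 2)).add
    (hs.div_const 2)
  have h := hf.mul (((((hA.pow 2).sub (hB.pow 2)).add ((hc.div_const 2).pow 2)).sub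
    (((ha.sub hb).div_const 2).pow 2)).add
    (((((hu.pow 2).const_add 1).sub (hy.pow 2)).div_const 2).mul hP))
  refine h.congr_deriv ?_
  simp only [Pi.add_apply, Pi.mul_apply, Pi.sub_apply, Pi.pow_apply]
  push_cast
  ring

lemma hasDerivAt_curY (hf : HasDerivAt f f' t) (hu : HasDerivAt u u' t) (hy : HasDerivAt y y' t)
    (hs : HasDerivAt s s' t) (ha : HasDerivAt a a' t) (hb : HasDerivAt b b' t)
    (hc : HasDerivAt c c' t) (hP : HasDerivAt P P' t) :
    HasDerivAt (fun r => curY (f r) (u r) (y r) (s r) (a r) (b r) (c r) (P r))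
      (f' * (2 * (y t * (a t + b t) / 2 + u t * c t / 2)
            * (u t * (a t - b t) / 2 + y t * c t / 2 + s t / 2)
          + 2 * (c t / 2) * ((a t - b t) / 2) - u t * y t * P t)
        + f t * ((y' * (a t + b t) + y t * (a' + b') + u' * c t + u t * c')
            * (u t * (a t - b t) / 2 + y t * c t / 2 + s t / 2)
          + (y t * (a t + b t) / 2 + u t * c t / 2)
            * (u' * (a t - b t) + u t * (a' - b') + y' * c t + y t * c' + s')
          + c' * (a t - b t) / 2 + c t * (a' - b') / 2
          - (u' * y t + u t * y') * P t - u t * y t * P')) t := by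
  have hA := ((hy.mul (ha.add hb)).div_const 2).add ((hu.mul hc).div_const 2)
  have hB := (((hu.mul (ha.sub hb)).div_const 2).add ((hy.mul hc).div_const 2)).add
    (hs.div_const 2)
  have h := hf.mul ((((hA.const_mul 2).mul hB).add
    (((hc.div_const 2).const_mul 2).mul ((ha.sub hb).div_const 2))).sub ((hu.mul hy).mul hP))
  refine h.congr_deriv ?_
  simp only [Pi.add_apply, Pi.mul_apply, Pi.sub_apply]
  ring

end Derivatives

lemma curT_nonneg {f u y s a b c P : ℝ} (hf : 0 ≤ f) (hP : 0 ≤ P) :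
    0 ≤ curT f u y s a b c P := by
  unfold curT; positivity

lemma half_mul_le_curT {f u y s a b c P : ℝ} (hf : 0 ≤ f) (hP : 0 ≤ P) :
    f * ((1 + u ^ 2) / 2 * P) ≤ curT f u y s a b c P := by
  unfold curT
  refine mul_le_mul_of_nonneg_left ?_ hf
  nlinarith [sq_nonneg (y * (a + b) / 2 + u * c / 2),
    sq_nonneg (u * (a - b) / 2 + y * c / 2 + s / 2), sq_nonneg (c / 2), sq_nonneg ((a - b) / 2),
    mul_nonneg (sq_nonneg y) hP]

lemma mul_add_mul_le_of_sq_add_sq_le {α β X Y Z : ℝ} (h : α ^ 2 + β ^ 2 ≤ 1) (hZ : 0 ≤ Z)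
    (hXY : X ^ 2 + Y ^ 2 ≤ Z ^ 2) : α * X + β * Y ≤ Z := by
  refine le_of_abs_le (abs_le_of_sq_le_sq ?_ hZ)
  nlinarith [sq_nonneg (α * Y - β * X), mul_le_mul h hXY (by positivity) zero_le_one]

/-- Dominant energy condition: the current is causal. -/
lemma curX_curY_le_curT {f u y s a b c P α β : ℝ} (h : α ^ 2 + β ^ 2 ≤ 1) (hf : 0 ≤ f)
    (hP : 0 ≤ P) :
    α * curX f u y s a b c P + β * curY f u y s a b c P ≤ curT f u y s a b c P := by
  unfold curT curX curY
  set A := y * (a + b) / 2 + u * c / 2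
  set B := u * (a - b) / 2 + y * c / 2 + s / 2
  set k := c / 2
  set l := (a - b) / 2
  have h1 : α * (A ^ 2 - B ^ 2) + β * (2 * A * B) ≤ A ^ 2 + B ^ 2 :=
    mul_add_mul_le_of_sq_add_sq_le h (by positivity) (by nlinarith)
  have h2 : α * (k ^ 2 - l ^ 2) + β * (2 * k * l) ≤ k ^ 2 + l ^ 2 :=
    mul_add_mul_le_of_sq_add_sq_le h (by positivity) (by nlinarith)
  have h3 : α * ((1 + u ^ 2 - y ^ 2) / 2) + β * (-(u * y)) ≤ (1 + u ^ 2 + y ^ 2) / 2 :=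
    mul_add_mul_le_of_sq_add_sq_le h (by positivity) (by nlinarith [sq_nonneg y])
  have h4 := mul_le_mul_of_nonneg_right h3 hP
  have h5 := mul_le_mul_of_nonneg_left (add_le_add (add_le_add h1 h2) h4) hf
  linarith

/-! ### The current of a solution -/

/-- The time direction in space-time. -/
def dirT : ℝ × E2 := (1, 0)

/-- The `i`-th spatial direction in space-time. -/
def dirX (i : Fin 2) : ℝ × E2 := (0, EuclideanSpace.single i 1)

/-- Evaluate a component of the current on a function on space-time. -/
def currentOf (k : ℝ → ℝ → ℝ → ℝ → ℝ → ℝ → ℝ → ℝ → ℝ) (p : ℝ) (Φ : ℝ × E2 → ℝ)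
    (q : ℝ × E2) : ℝ :=
  k (nullWeight ((5 - p) / 4) (q.1 - q.2 0)) (q.1 - q.2 0) (q.2 1) (Φ q) (fderiv ℝ Φ q dirT)
    (fderiv ℝ Φ q (dirX 0)) (fderiv ℝ Φ q (dirX 1)) (|Φ q| ^ (p + 1) / (p + 1))

lemma two_le_infty : (2 : WithTop ℕ∞) ≤ ((⊤ : ℕ∞) : WithTop ℕ∞) := by
  change ((2 : ℕ∞) : WithTop ℕ∞) ≤ _
  exact WithTop.coe_le_coe.2 le_top

lemma one_add_one_le_infty : (1 + 1 : WithTop ℕ∞) ≤ ((⊤ : ℕ∞) : WithTop ℕ∞) := by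
  rw [one_add_one_eq_two]
  exact two_le_infty

lemma hasDerivAt_comp_line {N : Type*} [NormedAddCommGroup N] [NormedSpace ℝ N]
    {V : Type*} [NormedAddCommGroup V] [NormedSpace ℝ V] {F : V → N} {q : V}
    (hF : DifferentiableAt ℝ F q) (v : V) :
    HasDerivAt (fun s : ℝ => F (q + s • v)) (fderiv ℝ F q v) 0 :=
  hF.hasFDerivAt.hasLineDerivAt v

section Current

variable {p : ℝ} {Φ : ℝ × E2 → ℝ}

lemma contDiff_fderiv_apply_const (hΦ : ContDiff ℝ (⊤ : ℕ∞) Φ) (w : ℝ × E2) :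
    ContDiff ℝ 1 fun q => fderiv ℝ Φ q w :=
  (hΦ.fderiv_right (m := 1) one_add_one_le_infty).clm_apply contDiff_const

lemma contDiff_abs_rpow (hp : 1 < p) (hΦ : ContDiff ℝ (⊤ : ℕ∞) Φ) :
    ContDiff ℝ 1 fun q => |Φ q| ^ (p + 1) / (p + 1) := by
  have h1 : ContDiff ℝ 1 fun s : ℝ => ‖s‖ ^ (p + 1) := contDiff_norm_rpow (by linarith)
  exact (h1.comp (hΦ.of_le (by exact_mod_cast le_top))).div_const _

lemma contDiff_coordU : ContDiff ℝ 1 fun q : ℝ × E2 => q.1 - q.2 0 := by fun_prop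

lemma contDiff_coordY : ContDiff ℝ 1 fun q : ℝ × E2 => q.2 1 := by fun_prop

lemma contDiff_currentOf (hp : 1 < p) (hΦ : ContDiff ℝ (⊤ : ℕ∞) Φ) :
    ContDiff ℝ 1 (currentOf curT p Φ) ∧ ContDiff ℝ 1 (currentOf curX p Φ) ∧
      ContDiff ℝ 1 (currentOf curY p Φ) := by
  have hf := (contDiff_nullWeight ((5 - p) / 4)).comp contDiff_coordU
  have hu := contDiff_coordU
  have hy := contDiff_coordY
  have hs : ContDiff ℝ 1 Φ := hΦ.of_le (by exact_mod_cast le_top)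
  have ha := contDiff_fderiv_apply_const hΦ dirT
  have hb := contDiff_fderiv_apply_const hΦ (dirX 0)
  have hc := contDiff_fderiv_apply_const hΦ (dirX 1)
  have hP := contDiff_abs_rpow hp hΦ
  have hA := ((hy.mul (ha.add hb)).div_const 2).add ((hu.mul hc).div_const 2)
  have hB := (((hu.mul (ha.sub hb)).div_const 2).add ((hy.mul hc).div_const 2)).add
    (hs.div_const 2)
  have h1 : ContDiff ℝ 1 fun _ : ℝ × E2 => (1 : ℝ) := contDiff_const
  have h2 : ContDiff ℝ 1 fun _ : ℝ × E2 => (2 : ℝ) := contDiff_const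
  refine ⟨hf.mul (((((hA.pow 2).add (hB.pow 2)).add ((hc.div_const 2).pow 2)).add
      (((ha.sub hb).div_const 2).pow 2)).add
      ((((h1.add (hu.pow 2)).add (hy.pow 2)).div_const 2).mul hP)),
    hf.mul (((((hA.pow 2).sub (hB.pow 2)).add ((hc.div_const 2).pow 2)).sub
      (((ha.sub hb).div_const 2).pow 2)).add
      ((((h1.add (hu.pow 2)).sub (hy.pow 2)).div_const 2).mul hP)),
    hf.mul ((((h2.mul hA).mul hB).add
      ((h2.mul (hc.div_const 2)).mul ((ha.sub hb).div_const 2))).sub ((hu.mul hy).mul hP))⟩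

/-- The current of a solution has a divergence with a sign. -/
lemma fderiv_currentOf_le (hp1 : 1 < p) (hp5 : p < 5) (hΦ : ContDiff ℝ (⊤ : ℕ∞) Φ) (q : ℝ × E2)
    (hwave : fderiv ℝ (fderiv ℝ Φ) q dirT dirT
      - (fderiv ℝ (fderiv ℝ Φ) q (dirX 0) (dirX 0) + fderiv ℝ (fderiv ℝ Φ) q (dirX 1) (dirX 1))
        = -(|Φ q| ^ (p - 1) * Φ q)) :
    fderiv ℝ (currentOf curT p Φ) q dirT ≤ fderiv ℝ (currentOf curX p Φ) q (dirX 0)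
      + fderiv ℝ (currentOf curY p Φ) q (dirX 1) := by
  have hD : ∀ w, Differentiable ℝ fun q => fderiv ℝ Φ q w := fun w =>
    (contDiff_fderiv_apply_const hΦ w).differentiable one_ne_zero
  have hD' : Differentiable ℝ (fderiv ℝ Φ) :=
    (hΦ.fderiv_right (m := 1) one_add_one_le_infty).differentiable one_ne_zero
  have hu : ∀ v : ℝ × E2, HasDerivAt (fun s : ℝ => (q + s • v).1 - (q + s • v).2 0)
      (v.1 - v.2 0) 0 := by
    intro v
    simpa [Pi.sub_def] using (((hasDerivAt_id (0 : ℝ)).mul_const v.1).const_add q.1).sub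
      (((hasDerivAt_id (0 : ℝ)).mul_const (v.2 0)).const_add (q.2 0))
  have hy : ∀ v : ℝ × E2, HasDerivAt (fun s : ℝ => (q + s • v).2 1) (v.2 1) 0 := by
    intro v
    simpa using (((hasDerivAt_id (0 : ℝ)).mul_const (v.2 1)).const_add (q.2 1))
  have hf : ∀ v : ℝ × E2, HasDerivAt
      (fun s : ℝ => nullWeight ((5 - p) / 4) ((q + s • v).1 - (q + s • v).2 0))
      (deriv (nullWeight ((5 - p) / 4)) (q.1 - q.2 0) * (v.1 - v.2 0)) 0 := by
    intro v
    have h := ((contDiff_nullWeight ((5 - p) / 4)).differentiable one_ne_zero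
      ((q + (0 : ℝ) • v).1 - (q + (0 : ℝ) • v).2 0)).hasDerivAt.comp (0 : ℝ) (hu v)
    simpa [Function.comp_def] using h
  have hs : ∀ v : ℝ × E2, HasDerivAt (fun s : ℝ => Φ (q + s • v)) (fderiv ℝ Φ q v) 0 := fun v =>
    hasDerivAt_comp_line (hΦ.differentiable (by simp) q) v
  have hd : ∀ w v : ℝ × E2, HasDerivAt (fun s : ℝ => fderiv ℝ Φ (q + s • v) w)
      (fderiv ℝ (fderiv ℝ Φ) q v w) 0 := by
    intro w v
    have h := (hasDerivAt_comp_line (hD' q) v).clm_apply (hasDerivAt_const (0 : ℝ) w)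
    simpa using h
  have hP : ∀ v : ℝ × E2, HasDerivAt (fun s : ℝ => |Φ (q + s • v)| ^ (p + 1) / (p + 1))
      (|Φ q| ^ (p - 1) * Φ q * fderiv ℝ Φ q v) 0 := by
    intro v
    have h := (((hasDerivAt_abs_rpow (Φ (q + (0 : ℝ) • v)) (by linarith : 1 < p + 1)).comp
      (0 : ℝ) (hs v))).div_const (p + 1)
    have hp : p + 1 ≠ 0 := by linarith
    refine h.congr_deriv ?_
    have : p + 1 - 2 = p - 1 := by ring
    rw [zero_smul, add_zero, this]
    field_simp
  obtain ⟨cT, cX, cY⟩ := contDiff_currentOf hp1 hΦ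
  have eT := (hasDerivAt_comp_line (cT.differentiable one_ne_zero q) dirT).unique
    (hasDerivAt_curT (hf dirT) (hu dirT) (hy dirT) (hs dirT) (hd dirT dirT) (hd (dirX 0) dirT)
      (hd (dirX 1) dirT) (hP dirT))
  have eX := (hasDerivAt_comp_line (cX.differentiable one_ne_zero q) (dirX 0)).unique
    (hasDerivAt_curX (hf (dirX 0)) (hu (dirX 0)) (hy (dirX 0)) (hs (dirX 0)) (hd dirT (dirX 0))
      (hd (dirX 0) (dirX 0)) (hd (dirX 1) (dirX 0)) (hP (dirX 0)))
  have eY := (hasDerivAt_comp_line (cY.differentiable one_ne_zero q) (dirX 1)).unique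
    (hasDerivAt_curY (hf (dirX 1)) (hu (dirX 1)) (hy (dirX 1)) (hs (dirX 1)) (hd dirT (dirX 1))
      (hd (dirX 0) (dirX 1)) (hd (dirX 1) (dirX 1)) (hP (dirX 1)))
  have hsymm : ∀ v w, fderiv ℝ (fderiv ℝ Φ) q v w = fderiv ℝ (fderiv ℝ Φ) q w v := fun v w =>
    (hΦ.contDiffAt.isSymmSndFDerivAt (by simpa using two_le_infty)).eq v w
  rw [eT, eX, eY, hsymm (dirX 0) dirT, hsymm (dirX 1) dirT, hsymm (dirX 1) (dirX 0)]
  simp only [zero_smul, add_zero]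
  have d1 : (dirT.1 : ℝ) = 1 := rfl
  have d2 : ∀ i, dirT.2 i = 0 := fun i => rfl
  have d3 : ∀ i, (dirX i).1 = 0 := fun i => rfl
  have d4 : (dirX 0).2 0 = 1 := by simp [dirX]
  have d5 : (dirX 0).2 1 = 0 := by simp [dirX]
  have d6 : (dirX 1).2 0 = 0 := by simp [dirX]
  have d7 : (dirX 1).2 1 = 1 := by simp [dirX]
  simp only [d1, d2, d3, d4, d5, d6, d7]
  have w1 := deriv_nullWeight_nonpos (m := (5 - p) / 4) (by linarith) (q.1 - q.2 0)
  have w2 := deriv_nullWeight_mul_le (m := (5 - p) / 4) (by linarith) (q.1 - q.2 0)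
  have hpot : |Φ q| ^ (p + 1) = |Φ q| ^ (p - 1) * Φ q * Φ q := by
    rw [mul_assoc, ← sq, ← sq_abs, ← Real.rpow_natCast, ← Real.rpow_add' (abs_nonneg _)]
    · congr 1; push_cast; ring
    · push_cast; linarith
  have hPn : 0 ≤ |Φ q| ^ (p + 1) / (p + 1) := by positivity
  have hPe : |Φ q| ^ (p - 1) * Φ q * Φ q = (p + 1) * (|Φ q| ^ (p + 1) / (p + 1)) := by
    rw [← hpot]; field_simp
  generalize |Φ q| ^ (p + 1) / (p + 1) = P at *
  generalize |Φ q| ^ (p - 1) * Φ q = N at *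
  generalize nullWeight ((5 - p) / 4) (q.1 - q.2 0) = f at *
  generalize deriv (nullWeight ((5 - p) / 4)) (q.1 - q.2 0) = f' at *
  generalize q.1 - q.2 0 = u at *
  generalize q.2 1 = y at *
  generalize Φ q = s at *
  generalize fderiv ℝ Φ q dirT = a at *
  generalize fderiv ℝ Φ q (dirX 0) = b at *
  generalize fderiv ℝ Φ q (dirX 1) = c at *
  generalize fderiv ℝ (fderiv ℝ Φ) q dirT dirT = Htt at *
  generalize fderiv ℝ (fderiv ℝ Φ) q (dirX 0) (dirX 0) = H00 at *
  generalize fderiv ℝ (fderiv ℝ Φ) q (dirX 1) (dirX 1) = H11 at *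
  generalize fderiv ℝ (fderiv ℝ Φ) q dirT (dirX 0) = Ht0 at *
  generalize fderiv ℝ (fderiv ℝ Φ) q dirT (dirX 1) = Ht1 at *
  generalize fderiv ℝ (fderiv ℝ Φ) q (dirX 0) (dirX 1) = H01 at *
  have k1 : f' * (2 * ((y * (a + b) / 2 + u * c / 2) ^ 2 + (c / 2) ^ 2)) ≤ 0 :=
    mul_nonpos_of_nonpos_of_nonneg w1 (by positivity)
  have k2 := mul_le_mul_of_nonneg_right w2 hPn
  have hH : Htt = H00 + H11 - N := by linarith
  subst hH
  linear_combination k1 + k2 - f * u / 2 * hPe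

end Current

/-! ### Monotonicity of truncated energies -/

lemma integral_fderiv_apply_eq_zero {g : E2 → ℝ} (hg : ContDiff ℝ 1 g)
    (hc : HasCompactSupport g) (v : E2) : ∫ x, fderiv ℝ g x v = 0 := by
  have hcont : Continuous fun x => fderiv ℝ g x v :=
    (hg.continuous_fderiv one_ne_zero).clm_apply continuous_const
  have hi : Integrable fun x => fderiv ℝ g x v :=
    hcont.integrable_of_hasCompactSupport (hc.fderiv_apply ℝ v)
  have h := integral_mul_fderiv_eq_neg_fderiv_mul_of_integrable (μ := (volume : Measure E2))
    (f := fun _ => (1 : ℝ)) (g := g) (v := v) (by simp) (by simpa using hi)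
    (by simpa using hg.continuous.integrable_of_hasCompactSupport hc)
    (fun x _ => by fun_prop) (fun x _ => (hg.differentiable one_ne_zero) x)
  simpa using h

lemma hasCompactSupport_of_norm {g : E2 → ℝ} {R : ℝ} (h : ∀ x, R < ‖x‖ → g x = 0) :
    HasCompactSupport g :=
  HasCompactSupport.intro (isCompact_closedBall (0 : E2) R) fun x hx => h x (by simpa using hx)

lemma fderiv_slice {X : ℝ × E2 → ℝ} (hX : Differentiable ℝ X) (s : ℝ) (x : E2) (v : E2) :
    fderiv ℝ (fun z => X (s, z)) x v = fderiv ℝ X (s, x) (0, v) := by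
  have h := (hX (s, x)).hasFDerivAt.comp x (hasFDerivAt_prodMk_right s x)
  have h' : fderiv ℝ (fun z => X (s, z)) x = _ := h.fderiv
  rw [h']
  simp

lemma hasDerivAt_time_slice {X : ℝ × E2 → ℝ} (hX : Differentiable ℝ X) (s : ℝ) (x : E2) :
    HasDerivAt (fun r => X (r, x)) (fderiv ℝ X (s, x) (1, 0)) s := by
  have h := (hX (s, x)).hasFDerivAt.comp_hasDerivAt s
    ((hasDerivAt_id s).prodMk (hasDerivAt_const s x))
  exact h

/-- If `∂ₜG ≤ div (X, Y)` and the functions are compactly supported in space, then `∫ G` is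
nonincreasing. -/
lemma integral_le_of_fderiv_le_div {G X Y : ℝ × E2 → ℝ} (hG : ContDiff ℝ 1 G)
    (hX : ContDiff ℝ 1 X) (hY : ContDiff ℝ 1 Y) {R T : ℝ} (hT : 0 ≤ T)
    (sG : ∀ s x, 0 ≤ s → R < ‖x‖ → G (s, x) = 0) (sX : ∀ s x, 0 ≤ s → R < ‖x‖ → X (s, x) = 0)
    (sY : ∀ s x, 0 ≤ s → R < ‖x‖ → Y (s, x) = 0)
    (hle : ∀ s x, 0 ≤ s → fderiv ℝ G (s, x) dirT ≤
      fderiv ℝ X (s, x) (dirX 0) + fderiv ℝ Y (s, x) (dirX 1)) :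
    ∫ x, G (T, x) ≤ ∫ x, G (0, x) := by
  have slice : ∀ {F : ℝ × E2 → ℝ}, ContDiff ℝ 1 F → ∀ s, ContDiff ℝ 1 fun x => F (s, x) :=
    fun hF s => hF.comp (contDiff_const.prodMk contDiff_id)
  have cG : Continuous fun q => fderiv ℝ G q dirT :=
    (hG.continuous_fderiv one_ne_zero).clm_apply continuous_const
  have sG' : ∀ s x, 0 < s → R < ‖x‖ → fderiv ℝ G (s, x) dirT = 0 := by
    intro s x hs hx
    have h1 := hasDerivAt_time_slice (hG.differentiable one_ne_zero) s x
    have h2 : HasDerivAt (fun r => G (r, x)) 0 s := by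
      refine (hasDerivAt_const s (0 : ℝ)).congr_of_eventuallyEq ?_
      filter_upwards [lt_mem_nhds hs] with r hr
      exact sG r x hr.le hx
    exact h1.unique h2
  have hGint : Integrable (Function.uncurry fun s x => fderiv ℝ G (s, x) dirT)
      ((volume.restrict (uIoc 0 T)).prod (volume : Measure E2)) := by
    have h1 : IntegrableOn (fun q : ℝ × E2 => fderiv ℝ G q dirT)
        (Icc 0 T ×ˢ Metric.closedBall (0 : E2) R) (volume.prod volume) :=
      cG.continuousOn.integrableOn_compact
        (isCompact_Icc.prod (isCompact_closedBall _ _))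
    have h2 : IntegrableOn (fun q : ℝ × E2 => fderiv ℝ G q dirT)
        (Ioc 0 T ×ˢ univ) (volume.prod volume) := by
      refine (h1.mono_set (s := Ioc 0 T ×ˢ Metric.closedBall (0 : E2) R)
        (prod_mono Ioc_subset_Icc_self subset_rfl)).of_forall_sdiff_eq_zero
        (measurableSet_Ioc.prod MeasurableSet.univ) ?_
      rintro ⟨s, x⟩ ⟨⟨hs, -⟩, hx⟩
      refine sG' s x hs.1 ?_
      by_contra! hc
      exact hx ⟨hs, by simpa using hc⟩
    rw [uIoc_of_le hT]
    rw [IntegrableOn, ← Measure.prod_restrict, Measure.restrict_univ] at h2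
    exact h2
  have hswap := intervalIntegral_integral_swap hGint
  have hftc : ∀ x, ∫ s in (0 : ℝ)..T, fderiv ℝ G (s, x) dirT = G (T, x) - G (0, x) := fun x =>
    intervalIntegral.integral_eq_sub_of_hasDerivAt
      (fun s _ => hasDerivAt_time_slice (hG.differentiable one_ne_zero) s x)
      ((cG.comp (by fun_prop : Continuous fun s : ℝ => (s, x))).intervalIntegrable _ _)
  have iG : ∀ s, 0 ≤ s → Integrable fun x => G (s, x) := fun s hs =>
    (slice hG s).continuous.integrable_of_hasCompactSupport
      (hasCompactSupport_of_norm fun x => sG s x hs)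
  have iD : ∀ {F : ℝ × E2 → ℝ}, ContDiff ℝ 1 F → (∀ s x, 0 ≤ s → R < ‖x‖ → F (s, x) = 0) →
      ∀ s, 0 ≤ s → ∀ i, Integrable (fun x => fderiv ℝ F (s, x) (dirX i)) ∧
        ∫ x, fderiv ℝ F (s, x) (dirX i) = 0 := by
    intro F hF sF s hs i
    have hcs := hasCompactSupport_of_norm fun x => sF s x hs
    have e : (fun x => fderiv ℝ F (s, x) (dirX i))
        = fun x => fderiv ℝ (fun z => F (s, z)) x (EuclideanSpace.single i 1) := by
      funext x
      rw [fderiv_slice (hF.differentiable one_ne_zero)]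
      rfl
    rw [e]
    exact ⟨(((slice hF s).continuous_fderiv one_ne_zero).clm_apply
      continuous_const).integrable_of_hasCompactSupport (hcs.fderiv_apply ℝ _),
      integral_fderiv_apply_eq_zero (slice hF s) hcs _⟩
  simp_rw [hftc] at hswap
  rw [integral_sub (iG T hT) (iG 0 le_rfl)] at hswap
  have hneg : ∫ s in (0 : ℝ)..T, ∫ x, fderiv ℝ G (s, x) dirT ≤ 0 := by
    rw [intervalIntegral.integral_of_le hT]
    refine setIntegral_nonpos measurableSet_Ioc fun s hs => ?_
    obtain ⟨iX, zX⟩ := iD hX sX s hs.1.le 0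
    obtain ⟨iY, zY⟩ := iD hY sY s hs.1.le 1
    have hs' : Continuous fun x : E2 => fderiv ℝ G (s, x) dirT :=
      cG.comp (by fun_prop : Continuous fun x : E2 => (s, x))
    calc ∫ x, fderiv ℝ G (s, x) dirT
        ≤ ∫ x, (fderiv ℝ X (s, x) (dirX 0) + fderiv ℝ Y (s, x) (dirX 1)) :=
          integral_mono (hs'.integrable_of_hasCompactSupport
            (hasCompactSupport_of_norm fun x => sG' s x hs.1)) (iX.add iY)
            fun x => hle s x hs.1.le
      _ = 0 := by rw [integral_add iX iY, zX, zY, add_zero]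
  linarith

/-- A smooth cutoff to the truncated backward cone `t + √(1 + |x|²) ≤ R`. -/
def coneCutoff (R : ℝ) (q : ℝ × E2) : ℝ :=
  Real.smoothTransition (R - (q.1 + √(1 + ‖q.2‖ ^ 2)))

lemma hasFDerivAt_sqrt_one_add_norm_sq (x : E2) :
    HasFDerivAt (fun z : E2 => √(1 + ‖z‖ ^ 2))
      ((1 / (2 * √(1 + ‖x‖ ^ 2))) • (2 • innerSL ℝ x)) x := by
  have h : HasFDerivAt (fun z : E2 => 1 + ‖z‖ ^ 2) (2 • innerSL ℝ x) x :=
    (hasStrictFDerivAt_norm_sq x).hasFDerivAt.const_add 1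
  exact h.sqrt (by positivity)

lemma contDiff_coneCutoff (R : ℝ) : ContDiff ℝ 1 (coneCutoff R) := by
  have h : ContDiff ℝ 1 fun q : ℝ × E2 => √(1 + ‖q.2‖ ^ 2) :=
    ContDiff.sqrt (contDiff_const.add (contDiff_snd.norm_sq ℝ)) fun q => by positivity
  exact (Real.smoothTransition.contDiff (n := 1)).comp
    (contDiff_const.sub (contDiff_fst.add h))

lemma coneCutoff_nonneg (R : ℝ) (q : ℝ × E2) : 0 ≤ coneCutoff R q :=
  Real.smoothTransition.nonneg _

lemma coneCutoff_le_one (R : ℝ) (q : ℝ × E2) : coneCutoff R q ≤ 1 :=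
  Real.smoothTransition.le_one _

lemma coneCutoff_eq_zero {R s : ℝ} {x : E2} (hs : 0 ≤ s) (hx : R < ‖x‖) :
    coneCutoff R (s, x) = 0 := by
  refine Real.smoothTransition.zero_of_nonpos ?_
  have : ‖x‖ ≤ √(1 + ‖x‖ ^ 2) := Real.le_sqrt_of_sq_le (by linarith)
  simp only
  linarith

lemma coneCutoff_eq_one {R : ℝ} {q : ℝ × E2} (h : q.1 + √(1 + ‖q.2‖ ^ 2) + 1 ≤ R) :
    coneCutoff R q = 1 :=
  Real.smoothTransition.one_of_one_le (by linarith)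

lemma fderiv_coneCutoff (R : ℝ) (q : ℝ × E2) : ∃ d ≥ 0, fderiv ℝ (coneCutoff R) q dirT = -d ∧
    ∀ i, fderiv ℝ (coneCutoff R) q (dirX i) = -(d * (q.2 i / √(1 + ‖q.2‖ ^ 2))) := by
  refine ⟨deriv Real.smoothTransition (R - (q.1 + √(1 + ‖q.2‖ ^ 2))),
    Real.smoothTransition.monotone.deriv_nonneg, ?_⟩
  have h1 := (hasFDerivAt_sqrt_one_add_norm_sq q.2).comp q
    (hasFDerivAt_snd (𝕜 := ℝ) (E := ℝ) (F := E2) (p := q))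
  have h2 := ((hasFDerivAt_fst (𝕜 := ℝ) (E := ℝ) (F := E2) (p := q)).add h1).const_sub R
  have h3 := (((Real.smoothTransition.contDiff (n := 1)).differentiable one_ne_zero)
    (R - (q.1 + √(1 + ‖q.2‖ ^ 2)))).hasDerivAt.comp_hasFDerivAt q h2
  have h4 : fderiv ℝ (coneCutoff R) q = _ := h3.fderiv
  rw [h4]
  have hq : √(1 + ‖q.2‖ ^ 2) ≠ 0 := by positivity
  refine ⟨by simp [dirT], fun i => ?_⟩
  simp [dirX, EuclideanSpace.inner_single_right]
  left
  field_simp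

/-- The energy in truncated backward cones is nonincreasing. -/
lemma integral_coneCutoff_mul_le {p : ℝ} {Φ : ℝ × E2 → ℝ} (hp1 : 1 < p) (hp5 : p < 5)
    (hΦ : ContDiff ℝ (⊤ : ℕ∞) Φ)
    (hwave : ∀ q, fderiv ℝ (fderiv ℝ Φ) q dirT dirT
      - (fderiv ℝ (fderiv ℝ Φ) q (dirX 0) (dirX 0) + fderiv ℝ (fderiv ℝ Φ) q (dirX 1) (dirX 1))
        = -(|Φ q| ^ (p - 1) * Φ q)) (R : ℝ) {T : ℝ} (hT : 0 ≤ T) :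
    ∫ x, coneCutoff R (T, x) * currentOf curT p Φ (T, x) ≤
      ∫ x, coneCutoff R (0, x) * currentOf curT p Φ (0, x) := by
  obtain ⟨cT, cX, cY⟩ := contDiff_currentOf hp1 hΦ
  have cR := contDiff_coneCutoff R
  have prod : ∀ {K : ℝ × E2 → ℝ}, ContDiff ℝ 1 K → ∀ q v,
      fderiv ℝ (fun q => coneCutoff R q * K q) q v
        = coneCutoff R q * fderiv ℝ K q v + K q * fderiv ℝ (coneCutoff R) q v := by
    intro K hK q v
    have h : fderiv ℝ (fun q => coneCutoff R q * K q) q = _ :=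
      fderiv_fun_mul (cR.differentiable one_ne_zero q) (hK.differentiable one_ne_zero q)
    rw [h]
    simp
  refine integral_le_of_fderiv_le_div (G := fun q => coneCutoff R q * currentOf curT p Φ q)
    (X := fun q => coneCutoff R q * currentOf curX p Φ q)
    (Y := fun q => coneCutoff R q * currentOf curY p Φ q) (R := R)
    (cR.mul cT) (cR.mul cX) (cR.mul cY) hT
    (fun s x hs hx => by simp [coneCutoff_eq_zero hs hx])
    (fun s x hs hx => by simp [coneCutoff_eq_zero hs hx])
    (fun s x hs hx => by simp [coneCutoff_eq_zero hs hx]) ?_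
  intro s x _
  obtain ⟨d, hd, hdT, hdX⟩ := fderiv_coneCutoff R (s, x)
  rw [prod cT, prod cX, prod cY, hdT, hdX, hdX]
  have h1 := mul_le_mul_of_nonneg_left (fderiv_currentOf_le hp1 hp5 hΦ (s, x) (hwave _))
    (coneCutoff_nonneg R (s, x))
  have hunit : (x 0 / √(1 + ‖x‖ ^ 2)) ^ 2 + (x 1 / √(1 + ‖x‖ ^ 2)) ^ 2 ≤ 1 := by
    have hq : (0 : ℝ) < 1 + ‖x‖ ^ 2 := by positivity
    rw [div_pow, div_pow, ← add_div, Real.sq_sqrt hq.le, div_le_one hq]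
    have := EuclideanSpace.norm_sq_eq x
    simp only [Fin.sum_univ_two, Real.norm_eq_abs, sq_abs] at this
    linarith
  have h2 : x 0 / √(1 + ‖x‖ ^ 2) * currentOf curX p Φ (s, x)
      + x 1 / √(1 + ‖x‖ ^ 2) * currentOf curY p Φ (s, x) ≤ currentOf curT p Φ (s, x) :=
    curX_curY_le_curT hunit (nullWeight_pos _ _).le (by positivity)
  have h3 := mul_le_mul_of_nonneg_left h2 hd
  linarith

/-! ### A Hardy inequality -/

lemma integral_fderiv_apply_eq_zero_of_integrable {g : E2 → ℝ} (hg : Differentiable ℝ g) {v : E2}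
    (hi : Integrable g) (hi' : Integrable fun x => fderiv ℝ g x v) :
    ∫ x, fderiv ℝ g x v = 0 := by
  have h := integral_mul_fderiv_eq_neg_fderiv_mul_of_integrable (μ := (volume : Measure E2))
    (f := fun _ => (1 : ℝ)) (g := g) (v := v) (by simp) (by simpa using hi')
    (by simpa using hi) (fun x _ => by fun_prop) (fun x _ => hg x)
  simpa using h

/-- A smooth approximation of the identity vanishing to third order at the origin. -/
def cubicCutoff (δ s : ℝ) : ℝ := s ^ 3 / (s ^ 2 + δ)

section CubicCutoff

variable {δ : ℝ}

lemma hasDerivAt_cubicCutoff (hδ : 0 < δ) (s : ℝ) :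
    HasDerivAt (cubicCutoff δ) ((s ^ 4 + 3 * δ * s ^ 2) / (s ^ 2 + δ) ^ 2) s := by
  have hs : s ^ 2 + δ ≠ 0 := by positivity
  refine ((hasDerivAt_pow 3 s).div ((hasDerivAt_pow 2 s).add_const δ) hs).congr_deriv ?_
  field_simp
  push_cast
  ring

lemma contDiff_cubicCutoff (hδ : 0 < δ) : ContDiff ℝ 1 (cubicCutoff δ) :=
  ContDiff.div (by fun_prop) (by fun_prop) fun s => by positivity

lemma sq_deriv_cubicCutoff_le (hδ : 0 < δ) (s : ℝ) :
    ((s ^ 4 + 3 * δ * s ^ 2) / (s ^ 2 + δ) ^ 2) ^ 2 ≤ 2 := by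
  have h0 : 0 ≤ (s ^ 4 + 3 * δ * s ^ 2) / (s ^ 2 + δ) ^ 2 := by positivity
  have h1 : (s ^ 4 + 3 * δ * s ^ 2) / (s ^ 2 + δ) ^ 2 ≤ 9 / 8 := by
    rw [div_le_iff₀ (by positivity)]
    nlinarith [sq_nonneg (s ^ 2 - 3 * δ)]
  nlinarith

lemma sq_cubicCutoff_le_sq (hδ : 0 < δ) (s : ℝ) : cubicCutoff δ s ^ 2 ≤ s ^ 2 := by
  have h : cubicCutoff δ s = s * (s ^ 2 / (s ^ 2 + δ)) := by
    rw [cubicCutoff]; ring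
  have h1 : s ^ 2 / (s ^ 2 + δ) ≤ 1 := (div_le_one (by positivity)).2 (by linarith)
  rw [h, mul_pow]
  exact mul_le_of_le_one_right (sq_nonneg s) (pow_le_one₀ (by positivity) h1)

lemma sq_cubicCutoff_le_rpow {p : ℝ} (hp1 : 1 < p) (hp5 : p < 5) (hδ : 0 < δ) (s : ℝ) :
    cubicCutoff δ s ^ 2 ≤ δ ^ ((5 - p) / 2 - 2) * |s| ^ (p + 1) := by
  have hs : 0 < s ^ 2 + δ := by positivity
  have h6 : s ^ 6 = |s| ^ (p + 1) * (s ^ 2) ^ ((5 - p) / 2) := by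
    have e1 : (s ^ 2) ^ ((5 - p) / 2) = |s| ^ (5 - p) := by
      rw [← sq_abs, ← Real.rpow_natCast, ← Real.rpow_mul (abs_nonneg s)]
      congr 1; push_cast; ring
    have e2 : s ^ 6 = |s| ^ 6 := (Even.pow_abs (by decide) s).symm
    rw [e1, e2, ← Real.rpow_add' (abs_nonneg s) (by ring_nf; norm_num), ← Real.rpow_natCast]
    congr 1; push_cast; ring
  have h1 : (s ^ 2) ^ ((5 - p) / 2) ≤ (s ^ 2 + δ) ^ ((5 - p) / 2) :=
    Real.rpow_le_rpow (sq_nonneg s) (by linarith) (by linarith)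
  have h2 : (s ^ 2 + δ) ^ ((5 - p) / 2) = (s ^ 2 + δ) ^ ((5 - p) / 2 - 2) * (s ^ 2 + δ) ^ 2 := by
    rw [← Real.rpow_natCast (s ^ 2 + δ) 2, ← Real.rpow_add hs]
    congr 1; push_cast; ring
  have h3 : (s ^ 2 + δ) ^ ((5 - p) / 2 - 2) ≤ δ ^ ((5 - p) / 2 - 2) :=
    Real.rpow_le_rpow_of_nonpos hδ (by nlinarith [sq_nonneg s]) (by linarith)
  rw [cubicCutoff, div_pow, div_le_iff₀ (by positivity), ← pow_mul]
  calc s ^ (3 * 2) = |s| ^ (p + 1) * (s ^ 2) ^ ((5 - p) / 2) := h6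
    _ ≤ |s| ^ (p + 1) * (δ ^ ((5 - p) / 2 - 2) * (s ^ 2 + δ) ^ 2) := by
        gcongr
        exact h1.trans (h2.le.trans (by gcongr))
    _ = _ := by ring

lemma tendsto_cubicCutoff (s : ℝ) :
    Tendsto (fun n : ℕ => cubicCutoff (1 / ((n : ℝ) + 1)) s) atTop (nhds s) := by
  rcases eq_or_ne s 0 with rfl | hs
  · simp [cubicCutoff]
  · have h := (tendsto_one_div_add_atTop_nhds_zero_nat (𝕜 := ℝ)).const_add (s ^ 2)
    have h2 : Tendsto (fun n : ℕ => s ^ 3 / (s ^ 2 + 1 / ((n : ℝ) + 1))) atTop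
        (nhds (s ^ 3 / (s ^ 2 + 0))) := tendsto_const_nhds.div h (by simpa using hs)
    have h3 : s ^ 3 / (s ^ 2 + 0) = s := by field_simp; ring
    rwa [h3] at h2

end CubicCutoff

lemma norm_sq_eq_coords (x : E2) : ‖x‖ ^ 2 = x 0 ^ 2 + x 1 ^ 2 := by
  simp [EuclideanSpace.norm_sq_eq]

lemma abs_coord_le_norm (x : E2) (i : Fin 2) : |x i| ≤ ‖x‖ := by
  simpa using PiLp.norm_apply_le x i

section Hardy

variable {p : ℝ} {g : E2 → ℝ}

lemma continuous_pdx (hg : ContDiff ℝ 1 g) (i : Fin 2) : Continuous (pdx i g) :=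
  (hg.continuous_fderiv one_ne_zero).clm_apply continuous_const

lemma continuous_gradSq (hg : ContDiff ℝ 1 g) : Continuous (gradSq g) :=
  continuous_finsetSum _ fun i _ => (continuous_pdx hg i).pow 2

lemma gradSq_nonneg (x : E2) : 0 ≤ gradSq g x := Finset.sum_nonneg fun _ _ => sq_nonneg _

lemma integral_sq_cubicCutoff_le (hp1 : 1 < p) (hp5 : p < 5) (hg : ContDiff ℝ 1 g)
    (hpot : Integrable fun x => (1 + ‖x‖) ^ 2 * |g x| ^ (p + 1))
    (hgrad : Integrable fun x => (1 + ‖x‖) ^ 2 * gradSq g x) {δ : ℝ} (hδ : 0 < δ) :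
    Integrable (fun x => cubicCutoff δ (g x) ^ 2) ∧
      ∫ x, cubicCutoff δ (g x) ^ 2 ≤ 2 * ∫ x, (1 + ‖x‖) ^ 2 * gradSq g x := by
  set C := δ ^ ((5 - p) / 2 - 2) with hC
  have hC0 : 0 ≤ C := by positivity
  set F' : ℝ → ℝ := fun s => (s ^ 4 + 3 * δ * s ^ 2) / (s ^ 2 + δ) ^ 2 with hF'
  have cF' : Continuous F' :=
    Continuous.div (by fun_prop) (by fun_prop) fun s => by positivity
  have cg := hg.continuous
  have cΨ : ContDiff ℝ 1 fun x => cubicCutoff δ (g x) := (contDiff_cubicCutoff hδ).comp hg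
  have hcoord : ∀ i, ContDiff ℝ 1 fun x : E2 => x i := fun i => by fun_prop
  have one_le : ∀ x : E2, 1 ≤ (1 + ‖x‖) ^ 2 := fun x => by nlinarith [norm_nonneg x]
  have bΨ : ∀ x, cubicCutoff δ (g x) ^ 2 ≤ C * |g x| ^ (p + 1) := fun x =>
    sq_cubicCutoff_le_rpow hp1 hp5 hδ (g x)
  have bP : ∀ x : E2, |g x| ^ (p + 1) ≤ (1 + ‖x‖) ^ 2 * |g x| ^ (p + 1) := fun x =>
    le_mul_of_one_le_left (by positivity) (one_le x)
  have iΨ : Integrable fun x => cubicCutoff δ (g x) ^ 2 := by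
    refine (hpot.const_mul C).mono' (cΨ.continuous.pow 2).aestronglyMeasurable
      (Eventually.of_forall fun x => ?_)
    rw [Real.norm_of_nonneg (sq_nonneg _)]
    exact (bΨ x).trans (mul_le_mul_of_nonneg_left (bP x) hC0)
  have hd : ∀ x i, fderiv ℝ (fun z : E2 => z i * cubicCutoff δ (g z) ^ 2) x
      (EuclideanSpace.single i 1)
        = cubicCutoff δ (g x) ^ 2 + 2 * cubicCutoff δ (g x) * (x i * (F' (g x) * pdx i g x)) := by
    intro x i
    have h1 := hasDerivAt_comp_line (hg.differentiable one_ne_zero x) (EuclideanSpace.single i 1)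
    have h2 : HasDerivAt (fun s : ℝ => (x + s • EuclideanSpace.single i (1 : ℝ) : E2) i) 1 0 := by
      simpa using (hasDerivAt_id (0 : ℝ)).const_add (x i)
    have h3 := h2.mul (((hasDerivAt_cubicCutoff hδ _).comp (0 : ℝ) h1).pow 2)
    have h4 := hasDerivAt_comp_line (((hcoord i).mul (cΨ.pow 2)).differentiable one_ne_zero x)
      (EuclideanSpace.single i (1 : ℝ))
    refine (h4.unique h3).trans ?_
    simp only [Pi.pow_apply, Function.comp, zero_smul, add_zero, pdx, hF']
    push_cast
    ring
  have bX : ∀ x i, (x i * (F' (g x) * pdx i g x)) ^ 2 ≤ 2 * ((1 + ‖x‖) ^ 2 * gradSq g x) := by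
    intro x i
    have h1 : x i ^ 2 ≤ (1 + ‖x‖) ^ 2 := by
      rw [← sq_abs]
      have := abs_coord_le_norm x i
      exact pow_le_pow_left₀ (abs_nonneg _) (by linarith) 2
    have h2 : pdx i g x ^ 2 ≤ gradSq g x :=
      Finset.single_le_sum (f := fun i => pdx i g x ^ 2) (fun _ _ => sq_nonneg _)
        (Finset.mem_univ i)
    calc (x i * (F' (g x) * pdx i g x)) ^ 2 = F' (g x) ^ 2 * (x i ^ 2 * pdx i g x ^ 2) := by ring
      _ ≤ 2 * ((1 + ‖x‖) ^ 2 * gradSq g x) := by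
        gcongr
        exact sq_deriv_cubicCutoff_le hδ _
  have iD : ∀ i, Integrable fun x : E2 => cubicCutoff δ (g x) ^ 2
      + 2 * cubicCutoff δ (g x) * (x i * (F' (g x) * pdx i g x)) := by
    intro i
    refine ((iΨ.const_mul 2).add (hgrad.const_mul 2)).mono'
      (((cΨ.continuous.pow 2).add ((continuous_const.mul cΨ.continuous).mul
        ((hcoord i).continuous.mul ((cF'.comp cg).mul
          (continuous_pdx hg i))))).aestronglyMeasurable) (Eventually.of_forall fun x => ?_)
    have h := bX x i
    simp only [Real.norm_eq_abs, Pi.add_apply]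
    rw [abs_le]
    constructor <;>
    nlinarith [sq_nonneg (cubicCutoff δ (g x) + x i * (F' (g x) * pdx i g x)),
      sq_nonneg (cubicCutoff δ (g x) - x i * (F' (g x) * pdx i g x)),
      sq_nonneg (cubicCutoff δ (g x))]
  have hz : ∀ i, ∫ x : E2, (cubicCutoff δ (g x) ^ 2
      + 2 * cubicCutoff δ (g x) * (x i * (F' (g x) * pdx i g x))) = 0 := by
    intro i
    have h := integral_fderiv_apply_eq_zero_of_integrable
      (g := fun z : E2 => z i * cubicCutoff δ (g z) ^ 2) (v := EuclideanSpace.single i 1)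
      (((hcoord i).mul (cΨ.pow 2)).differentiable one_ne_zero) ?_ ?_
    · simpa only [hd] using h
    · refine (hpot.const_mul C).mono'
        ((hcoord i).continuous.mul (cΨ.continuous.pow 2)).aestronglyMeasurable
        (Eventually.of_forall fun x => ?_)
      rw [norm_mul, Real.norm_of_nonneg (sq_nonneg (cubicCutoff δ (g x)))]
      have h1 : ‖x i‖ ≤ (1 + ‖x‖) ^ 2 := by
        have := abs_coord_le_norm x i
        rw [Real.norm_eq_abs]
        nlinarith [norm_nonneg x]
      calc ‖x i‖ * cubicCutoff δ (g x) ^ 2 ≤ (1 + ‖x‖) ^ 2 * (C * |g x| ^ (p + 1)) :=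
            mul_le_mul h1 (bΨ x) (sq_nonneg _) (by positivity)
        _ = _ := by ring
    · simpa only [hd] using iD i
  refine ⟨iΨ, ?_⟩
  have hsum : ∫ x : E2, ((cubicCutoff δ (g x) ^ 2
      + 2 * cubicCutoff δ (g x) * (x 0 * (F' (g x) * pdx 0 g x)))
      + (cubicCutoff δ (g x) ^ 2
      + 2 * cubicCutoff δ (g x) * (x 1 * (F' (g x) * pdx 1 g x)))) = 0 := by
    rw [integral_add (iD 0) (iD 1), hz, hz, add_zero]
  have hle : ∫ x, (cubicCutoff δ (g x) ^ 2 - 2 * ((1 + ‖x‖) ^ 2 * gradSq g x)) ≤ 0 := by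
    rw [← hsum]
    refine integral_mono (iΨ.sub (hgrad.const_mul 2)) ((iD 0).add (iD 1)) fun x => ?_
    have hcs : (x 0 * pdx 0 g x + x 1 * pdx 1 g x) ^ 2 ≤ (1 + ‖x‖) ^ 2 * gradSq g x := by
      have h1 : (x 0 * pdx 0 g x + x 1 * pdx 1 g x) ^ 2 ≤ ‖x‖ ^ 2 * gradSq g x := by
        rw [norm_sq_eq_coords, gradSq, Fin.sum_univ_two]
        nlinarith [sq_nonneg (x 0 * pdx 1 g x - x 1 * pdx 0 g x)]
      refine h1.trans (mul_le_mul_of_nonneg_right ?_ (gradSq_nonneg x))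
      nlinarith [norm_nonneg x]
    have h2 : (F' (g x) * (x 0 * pdx 0 g x + x 1 * pdx 1 g x)) ^ 2
        ≤ 2 * ((1 + ‖x‖) ^ 2 * gradSq g x) := by
      rw [mul_pow]
      exact mul_le_mul (sq_deriv_cubicCutoff_le hδ _) hcs (sq_nonneg _) (by norm_num)
    nlinarith [sq_nonneg (cubicCutoff δ (g x) + F' (g x) * (x 0 * pdx 0 g x + x 1 * pdx 1 g x))]
  rw [integral_sub iΨ (hgrad.const_mul 2), integral_const_mul] at hle
  linarith

/-- A Hardy inequality on the plane, localized by a cutoff. -/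
lemma integral_mul_sq_le (hp1 : 1 < p) (hp5 : p < 5) (hg : ContDiff ℝ 1 g)
    (hpot : Integrable fun x => (1 + ‖x‖) ^ 2 * |g x| ^ (p + 1))
    (hgrad : Integrable fun x => (1 + ‖x‖) ^ 2 * gradSq g x) {χ : E2 → ℝ} (hχ : Continuous χ)
    (hχc : HasCompactSupport χ) (hχ0 : ∀ x, 0 ≤ χ x) (hχ1 : ∀ x, χ x ≤ 1) :
    ∫ x, χ x * g x ^ 2 ≤ 2 * ∫ x, (1 + ‖x‖) ^ 2 * gradSq g x := by
  have hδ : ∀ n : ℕ, (0 : ℝ) < 1 / ((n : ℝ) + 1) := fun n => by positivity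
  have cΨ : ∀ n : ℕ, Continuous fun x => cubicCutoff (1 / ((n : ℝ) + 1)) (g x) := fun n =>
    (contDiff_cubicCutoff (hδ n)).continuous.comp hg.continuous
  have lim : Tendsto (fun n : ℕ => ∫ x, χ x * cubicCutoff (1 / ((n : ℝ) + 1)) (g x) ^ 2) atTop
      (nhds (∫ x, χ x * g x ^ 2)) := by
    refine tendsto_integral_of_dominated_convergence (fun x => χ x * g x ^ 2)
      (fun n => (hχ.mul ((cΨ n).pow 2)).aestronglyMeasurable)
      ((hχ.mul (hg.continuous.pow 2)).integrable_of_hasCompactSupport hχc.mul_right)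
      (fun n => Eventually.of_forall fun x => ?_)
      (Eventually.of_forall fun x => ((tendsto_cubicCutoff (g x)).pow 2).const_mul _)
    rw [Real.norm_of_nonneg (mul_nonneg (hχ0 x) (sq_nonneg _))]
    exact mul_le_mul_of_nonneg_left (sq_cubicCutoff_le_sq (hδ n) _) (hχ0 x)
  refine le_of_tendsto lim (Eventually.of_forall fun n => ?_)
  obtain ⟨hi, hle⟩ := integral_sq_cubicCutoff_le hp1 hp5 hg hpot hgrad (hδ n)
  refine le_trans (integral_mono ?_ hi fun x => ?_) hle
  · exact (hχ.mul ((cΨ n).pow 2)).integrable_of_hasCompactSupport hχc.mul_right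
  · exact mul_le_of_le_one_left (sq_nonneg _) (hχ1 x)

end Hardy

/-! ### Comparison of the current with the weighted energy and the potential -/

lemma curT_le {f u y s a b c P r Q : ℝ} (hf0 : 0 ≤ f) (hf2 : f ≤ 2) (hr : 0 ≤ r)
    (huy : u ^ 2 + y ^ 2 = r ^ 2) (hP : P ≤ Q / 2) (hQ : 0 ≤ Q) :
    curT f u y s a b c P
      ≤ 6 * ((1 + r) ^ 2 * (b ^ 2 + c ^ 2 + a ^ 2) + (1 + r) ^ 2 * Q) + s ^ 2 := by
  have hA : (y * (a + b) / 2 + u * c / 2) ^ 2 ≤ y ^ 2 * (a ^ 2 + b ^ 2) + u ^ 2 * c ^ 2 / 2 := by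
    nlinarith [sq_nonneg (y * (a + b) / 2 - u * c / 2), sq_nonneg (y * (a - b))]
  have hB : (u * (a - b) / 2 + y * c / 2) ^ 2
      ≤ u ^ 2 * (a ^ 2 + b ^ 2) + y ^ 2 * c ^ 2 / 2 := by
    nlinarith [sq_nonneg (u * (a - b) / 2 - y * c / 2), sq_nonneg (u * (a + b))]
  have hB' : (u * (a - b) / 2 + y * c / 2 + s / 2) ^ 2
      ≤ 2 * (u ^ 2 * (a ^ 2 + b ^ 2) + y ^ 2 * c ^ 2 / 2) + s ^ 2 / 2 := by
    nlinarith [sq_nonneg (u * (a - b) / 2 + y * c / 2 - s / 2)]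
  have hu : u ^ 2 ≤ r ^ 2 := by nlinarith [sq_nonneg y]
  have hr' : r ^ 2 + 1 ≤ (1 + r) ^ 2 := by nlinarith
  have hl : ((a - b) / 2) ^ 2 ≤ (a ^ 2 + b ^ 2) / 2 := by nlinarith [sq_nonneg (a + b)]
  have hQ' : (1 + u ^ 2 + y ^ 2) / 2 * P ≤ (1 + r) ^ 2 * Q / 4 := by
    have h1 : 1 + u ^ 2 + y ^ 2 ≤ (1 + r) ^ 2 := by linarith
    have h2 := mul_le_mul_of_nonneg_left hP (by positivity : 0 ≤ (1 + u ^ 2 + y ^ 2) / 2)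
    nlinarith [mul_le_mul_of_nonneg_right h1 hQ]
  have hy : y ^ 2 = r ^ 2 - u ^ 2 := by linarith
  set D := b ^ 2 + c ^ 2 + a ^ 2 with hD
  have hab : a ^ 2 + b ^ 2 ≤ D := by nlinarith [sq_nonneg c]
  have hcD : c ^ 2 ≤ D := by nlinarith [sq_nonneg a, sq_nonneg b]
  have hD0 : 0 ≤ D := by positivity
  have k1 : (y ^ 2 + 2 * u ^ 2) * (a ^ 2 + b ^ 2) + (u ^ 2 / 2 + y ^ 2) * c ^ 2
      ≤ 2 * r ^ 2 * D := by
    have e1 : (y ^ 2 + 2 * u ^ 2) * (a ^ 2 + b ^ 2) ≤ 2 * r ^ 2 * (a ^ 2 + b ^ 2) :=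
      mul_le_mul_of_nonneg_right (by linarith [sq_nonneg y]) (by positivity)
    have e2 : (u ^ 2 / 2 + y ^ 2) * c ^ 2 ≤ 2 * r ^ 2 * c ^ 2 :=
      mul_le_mul_of_nonneg_right (by linarith [sq_nonneg u, sq_nonneg r]) (by positivity)
    rw [hD]; linarith
  have k2 : 3 * (r ^ 2 + 1) * D ≤ 3 * (1 + r) ^ 2 * D :=
    mul_le_mul_of_nonneg_right (by linarith) hD0
  have k3 : 0 ≤ (1 + r) ^ 2 * Q := by positivity
  set S := (y * (a + b) / 2 + u * c / 2) ^ 2 + (u * (a - b) / 2 + y * c / 2 + s / 2) ^ 2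
    + (c / 2) ^ 2 + ((a - b) / 2) ^ 2 + (1 + u ^ 2 + y ^ 2) / 2 * P with hSd
  have hS : S ≤ 3 * (1 + r) ^ 2 * D + (1 + r) ^ 2 * Q + s ^ 2 / 2 := by
    have h1 := mul_nonneg (sq_nonneg r) hD0
    have h2 : (c / 2) ^ 2 = c ^ 2 / 4 := by ring
    rw [hSd]
    linarith
  have k4 : 0 ≤ 3 * (1 + r) ^ 2 * D + (1 + r) ^ 2 * Q + s ^ 2 / 2 := by positivity
  calc f * S ≤ f * (3 * (1 + r) ^ 2 * D + (1 + r) ^ 2 * Q + s ^ 2 / 2) :=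
        mul_le_mul_of_nonneg_left hS hf0
    _ ≤ 2 * (3 * (1 + r) ^ 2 * D + (1 + r) ^ 2 * Q + s ^ 2 / 2) :=
        mul_le_mul_of_nonneg_right hf2 k4
    _ ≤ _ := by linarith

lemma rpow_le_nullWeight_mul {p u : ℝ} (hp1 : 1 < p) (hp5 : p < 5) (hu : 0 ≤ u) :
    (u + 1) ^ ((p - 1) / 2) ≤ nullWeight ((5 - p) / 4) u * (2 * (1 + u ^ 2)) := by
  have h0 : 0 < 2 * (1 + u ^ 2) := by positivity
  calc (u + 1) ^ ((p - 1) / 2) = ((u + 1) ^ 2) ^ ((p - 1) / 4) := by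
        rw [← Real.rpow_natCast, ← Real.rpow_mul (by linarith)]
        congr 1; push_cast; ring
    _ ≤ (2 * (1 + u ^ 2)) ^ ((p - 1) / 4) :=
        Real.rpow_le_rpow (by positivity) (by nlinarith [sq_nonneg (u - 1)]) (by linarith)
    _ = (2 * (1 + u ^ 2)) ^ (-((5 - p) / 4)) * (2 * (1 + u ^ 2)) := by
        rw [← Real.rpow_add_one h0.ne']
        congr 1; ring
    _ ≤ _ := mul_le_mul_of_nonneg_right (le_nullWeight (by linarith) u) h0.le

section Solution

variable {p : ℝ} {φ : ℝ → E2 → ℝ}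

lemma pt_eq_fderiv (hΦ : ContDiff ℝ (⊤ : ℕ∞) fun q : ℝ × E2 => φ q.1 q.2) (t : ℝ) (x : E2) :
    pt φ t x = fderiv ℝ (fun q : ℝ × E2 => φ q.1 q.2) (t, x) dirT :=
  (hasDerivAt_time_slice (hΦ.differentiable (by simp)) t x).deriv

lemma pdx_eq_fderiv (hΦ : ContDiff ℝ (⊤ : ℕ∞) fun q : ℝ × E2 => φ q.1 q.2) (i : Fin 2) (t : ℝ)
    (x : E2) :
    pdx i (φ t) x = fderiv ℝ (fun q : ℝ × E2 => φ q.1 q.2) (t, x) (dirX i) :=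
  fderiv_slice (hΦ.differentiable (by simp)) t x _

lemma fderiv_fderiv_apply {Φ : ℝ × E2 → ℝ} (hΦ : ContDiff ℝ (⊤ : ℕ∞) Φ) (q v w : ℝ × E2) :
    fderiv ℝ (fun q => fderiv ℝ Φ q w) q v = fderiv ℝ (fderiv ℝ Φ) q v w := by
  have hD : Differentiable ℝ (fderiv ℝ Φ) :=
    (hΦ.fderiv_right (m := 1) one_add_one_le_infty).differentiable one_ne_zero
  rw [fderiv_clm_apply (hD q) (differentiableAt_const w)]
  simp

lemma wave_fderiv (hΦ : ContDiff ℝ (⊤ : ℕ∞) fun q : ℝ × E2 => φ q.1 q.2)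
    (hφ : IsWaveSolR2 p φ) (q : ℝ × E2) :
    fderiv ℝ (fderiv ℝ fun q : ℝ × E2 => φ q.1 q.2) q dirT dirT
      - (fderiv ℝ (fderiv ℝ fun q : ℝ × E2 => φ q.1 q.2) q (dirX 0) (dirX 0)
        + fderiv ℝ (fderiv ℝ fun q : ℝ × E2 => φ q.1 q.2) q (dirX 1) (dirX 1))
      = -(|φ q.1 q.2| ^ (p - 1) * φ q.1 q.2) := by
  obtain ⟨t, x⟩ := q
  have hD : ∀ w, Differentiable ℝ fun q => fderiv ℝ (fun q : ℝ × E2 => φ q.1 q.2) q w :=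
    fun w => (contDiff_fderiv_apply_const hΦ w).differentiable one_ne_zero
  have h1 : ptt φ t x = fderiv ℝ (fderiv ℝ fun q : ℝ × E2 => φ q.1 q.2) (t, x) dirT dirT := by
    have : (fun s => pt φ s x)
        = fun s => fderiv ℝ (fun q : ℝ × E2 => φ q.1 q.2) (s, x) dirT :=
      funext fun s => pt_eq_fderiv hΦ s x
    rw [ptt, this, ← fderiv_fderiv_apply hΦ]
    exact (hasDerivAt_time_slice (hD dirT) t x).deriv
  have h2 : ∀ i, pdx i (pdx i (φ t)) x
      = fderiv ℝ (fderiv ℝ fun q : ℝ × E2 => φ q.1 q.2) (t, x) (dirX i) (dirX i) := by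
    intro i
    have : pdx i (φ t)
        = fun z => fderiv ℝ (fun q : ℝ × E2 => φ q.1 q.2) (t, z) (dirX i) :=
      funext fun z => pdx_eq_fderiv hΦ i t z
    rw [pdx, this, ← fderiv_fderiv_apply hΦ]
    exact fderiv_slice (hD (dirX i)) t x _
  have h := hφ t x
  rwa [lap, Fin.sum_univ_two, h1, h2, h2] at h

lemma e02Integrand_nonneg (φ₀ φ₁ : E2 → ℝ) (x : E2) : 0 ≤ e02Integrand p φ₀ φ₁ x := by
  have := gradSq_nonneg (g := φ₀) x
  unfold e02Integrand; positivity

/-- The initial value of the truncated weighted energy is controlled by `E_{0,2}`. -/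
lemma integral_coneCutoff_mul_zero_le (hp1 : 1 < p) (hp5 : p < 5)
    (hΦ : ContDiff ℝ (⊤ : ℕ∞) fun q : ℝ × E2 => φ q.1 q.2)
    (hE : Integrable (e02Integrand p (φ 0) (pt φ 0))) (R : ℝ) :
    ∫ x, coneCutoff R (0, x) * currentOf curT p (fun q : ℝ × E2 => φ q.1 q.2) (0, x)
      ≤ 8 * E02R p (φ 0) (pt φ 0) := by
  have hslice : Continuous fun x : E2 => ((0 : ℝ), x) := by fun_prop
  have hg : ContDiff ℝ 1 (φ 0) :=
    (hΦ.of_le (by exact_mod_cast le_top : (1 : WithTop ℕ∞) ≤ ((⊤ : ℕ∞) : WithTop ℕ∞))).comp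
      (contDiff_const.prodMk contDiff_id)
  have hpow : Continuous fun x => |φ 0 x| ^ (p + 1) :=
    hg.continuous.abs.rpow_const fun x => Or.inr (by linarith)
  have hw : Continuous fun x : E2 => (1 + ‖x‖) ^ 2 := by fun_prop
  have hpot : Integrable fun x => (1 + ‖x‖) ^ 2 * |φ 0 x| ^ (p + 1) := by
    refine hE.mono' (hw.mul hpow).aestronglyMeasurable (Eventually.of_forall fun x => ?_)
    have h1 := gradSq_nonneg (g := φ 0) x
    have h2 : 0 ≤ (1 + ‖x‖) ^ 2 * (gradSq (φ 0) x + pt φ 0 x ^ 2) := by positivity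
    rw [Real.norm_of_nonneg (by positivity), e02Integrand]
    linarith
  have hle : ∀ x, (1 + ‖x‖) ^ 2 * gradSq (φ 0) x ≤ e02Integrand p (φ 0) (pt φ 0) x := by
    intro x
    have h2 : 0 ≤ (1 + ‖x‖) ^ 2 * pt φ 0 x ^ 2 := by positivity
    have h3 : 0 ≤ (1 + ‖x‖) ^ 2 * |φ 0 x| ^ (p + 1) := by positivity
    rw [e02Integrand]
    linarith
  have hgrad : Integrable fun x => (1 + ‖x‖) ^ 2 * gradSq (φ 0) x := by
    refine hE.mono' (hw.mul (continuous_gradSq hg)).aestronglyMeasurable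
      (Eventually.of_forall fun x => ?_)
    have h1 := gradSq_nonneg (g := φ 0) x
    rw [Real.norm_of_nonneg (by positivity)]
    exact hle x
  have hχ : Continuous fun x => coneCutoff R (0, x) := (contDiff_coneCutoff R).continuous.comp hslice
  have hχc : HasCompactSupport fun x => coneCutoff R (0, x) :=
    hasCompactSupport_of_norm fun x hx => coneCutoff_eq_zero le_rfl hx
  have hHardy := integral_mul_sq_le hp1 hp5 hg hpot hgrad hχ hχc
    (fun x => coneCutoff_nonneg R _) fun x => coneCutoff_le_one R _
  have hgradE : ∫ x, (1 + ‖x‖) ^ 2 * gradSq (φ 0) x ≤ E02R p (φ 0) (pt φ 0) :=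
    integral_mono hgrad hE hle
  have hs : Integrable fun x => coneCutoff R (0, x) * φ 0 x ^ 2 :=
    (hχ.mul (hg.continuous.pow 2)).integrable_of_hasCompactSupport hχc.mul_right
  have hcur : Integrable fun x =>
      coneCutoff R (0, x) * currentOf curT p (fun q : ℝ × E2 => φ q.1 q.2) (0, x) :=
    (hχ.mul ((contDiff_currentOf hp1 hΦ).1.continuous.comp
      hslice)).integrable_of_hasCompactSupport hχc.mul_right
  calc _ ≤ ∫ x, (6 * e02Integrand p (φ 0) (pt φ 0) x + coneCutoff R (0, x) * φ 0 x ^ 2) := by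
        refine integral_mono hcur ((hE.const_mul 6).add hs) fun x => ?_
        have hc0 := coneCutoff_nonneg R (0, x)
        have hc1 := coneCutoff_le_one R (0, x)
        have hQ : 0 ≤ |φ 0 x| ^ (p + 1) := by positivity
        have key : currentOf curT p (fun q : ℝ × E2 => φ q.1 q.2) (0, x)
            ≤ 6 * e02Integrand p (φ 0) (pt φ 0) x + φ 0 x ^ 2 := by
          rw [e02Integrand, gradSq, Fin.sum_univ_two, pdx_eq_fderiv hΦ, pdx_eq_fderiv hΦ,
            pt_eq_fderiv hΦ]
          refine curT_le (nullWeight_pos _ _).le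
            (nullWeight_le_two (by linarith) (by linarith) _) (norm_nonneg x) ?_ ?_ hQ
          · rw [norm_sq_eq_coords]; ring
          · exact div_le_div_of_nonneg_left hQ two_pos (by linarith)
        have h1 := mul_le_mul_of_nonneg_left key hc0
        have h2 := mul_le_mul_of_nonneg_right hc1 (e02Integrand_nonneg (p := p) (φ 0) (pt φ 0) x)
        simp only
        linarith
    _ = 6 * E02R p (φ 0) (pt φ 0) + ∫ x, coneCutoff R (0, x) * φ 0 x ^ 2 := by
        rw [integral_add (hE.const_mul 6) hs, integral_const_mul, E02R]
    _ ≤ _ := by linarith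

lemma rpow_mul_le_currentOf (hp1 : 1 < p) (hp5 : p < 5) {t : ℝ} {x : E2} (hx : 0 ≤ t - x 0) :
    (t - x 0 + 1) ^ ((p - 1) / 2) * |φ t x| ^ (p + 1)
      ≤ 24 * currentOf curT p (fun q : ℝ × E2 => φ q.1 q.2) (t, x) := by
  have hQ : 0 ≤ |φ t x| ^ (p + 1) := by positivity
  have hf := (nullWeight_pos ((5 - p) / 4) (t - x 0)).le
  have h1 := mul_le_mul_of_nonneg_right (rpow_le_nullWeight_mul hp1 hp5 hx) hQ
  have hP : |φ t x| ^ (p + 1) / 6 ≤ |φ t x| ^ (p + 1) / (p + 1) :=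
    div_le_div_of_nonneg_left hQ (by linarith) (by linarith)
  have h2 : nullWeight ((5 - p) / 4) (t - x 0)
      * ((1 + (t - x 0) ^ 2) / 2 * (|φ t x| ^ (p + 1) / (p + 1)))
        ≤ currentOf curT p (fun q : ℝ × E2 => φ q.1 q.2) (t, x) :=
    half_mul_le_curT hf (by positivity)
  have h3 := mul_le_mul_of_nonneg_left hP
    (by positivity : 0 ≤ nullWeight ((5 - p) / 4) (t - x 0) * ((1 + (t - x 0) ^ 2) / 2))
  linarith

end Solution

/-- half-space weighted potential bound on `ℝ^{1+2}`. -/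
theorem half_space_weighted_potential_bound
    (p : ℝ) (hp1 : 1 < p) (hp5 : p < 5) :
    ∃ C > 0, ∀ φ : ℝ → E2 → ℝ,
      ContDiff ℝ (⊤ : ℕ∞) (fun q : ℝ × E2 => φ q.1 q.2) →
      IsWaveSolR2 p φ →
      Integrable (e02Integrand p (φ 0) (pt φ 0)) →
      ∀ t : ℝ, 0 ≤ t →
        (∫ x in {x : E2 | x 0 ≤ 0}, (t - x 0 + 1) ^ ((p-1)/2) * |φ t x| ^ (p+1))
          ≤ C * E02R p (φ 0) (pt φ 0) := by
  refine ⟨192, by norm_num, fun φ hΦ hφ hE t ht => ?_⟩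
  set S : Set E2 := {x : E2 | x 0 ≤ 0} with hS
  set F : E2 → ℝ := fun x => (t - x 0 + 1) ^ ((p-1)/2) * |φ t x| ^ (p+1) with hF
  have hE0 : 0 ≤ E02R p (φ 0) (pt φ 0) := integral_nonneg fun x => e02Integrand_nonneg _ _ x
  have hSm : MeasurableSet S := (isClosed_le (by fun_prop) continuous_const).measurableSet
  by_cases hFi : IntegrableOn F S
  swap
  · rw [integral_undef hFi]; positivity
  have hslice : Continuous fun x : E2 => (t, x) := by fun_prop
  have hχ : ∀ n : ℕ, Continuous fun x => coneCutoff n (t, x) := fun n =>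
    (contDiff_coneCutoff n).continuous.comp hslice
  have hχ1 : ∀ (n : ℕ) x, ‖coneCutoff n (t, x) * F x‖ ≤ ‖F x‖ := fun n x => by
    rw [norm_mul, Real.norm_of_nonneg (coneCutoff_nonneg _ _)]
    exact mul_le_of_le_one_left (norm_nonneg _) (coneCutoff_le_one _ _)
  have hFm : ∀ n : ℕ, AEStronglyMeasurable (fun x => coneCutoff n (t, x) * F x)
      (volume.restrict S) := fun n => (hχ n).aestronglyMeasurable.mul hFi.aestronglyMeasurable
  have lim : Tendsto (fun n : ℕ => ∫ x in S, coneCutoff n (t, x) * F x) atTop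
      (nhds (∫ x in S, F x)) := by
    refine tendsto_integral_of_dominated_convergence (fun x => ‖F x‖) hFm hFi.norm
      (fun n => Eventually.of_forall (hχ1 n)) (Eventually.of_forall fun x => ?_)
    obtain ⟨N, hN⟩ := exists_nat_ge (t + √(1 + ‖x‖ ^ 2) + 1)
    refine tendsto_const_nhds.congr' ?_
    filter_upwards [eventually_ge_atTop N] with n hn
    have : (N : ℝ) ≤ n := by exact_mod_cast hn
    rw [coneCutoff_eq_one (by simpa using hN.trans this), one_mul]
  refine le_of_tendsto lim (Eventually.of_forall fun n => ?_)
  set J : E2 → ℝ := fun x =>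
    coneCutoff n (t, x) * currentOf curT p (fun q : ℝ × E2 => φ q.1 q.2) (t, x) with hJ
  have hJi : Integrable J :=
    ((hχ n).mul ((contDiff_currentOf hp1 hΦ).1.continuous.comp
      hslice)).integrable_of_hasCompactSupport
      (hasCompactSupport_of_norm (R := n) fun x hx => coneCutoff_eq_zero ht hx).mul_right
  have hJ0 : ∀ x, 0 ≤ J x := fun x =>
    mul_nonneg (coneCutoff_nonneg _ _) (curT_nonneg (nullWeight_pos _ _).le (by positivity))
  calc ∫ x in S, coneCutoff n (t, x) * F x ≤ ∫ x in S, 24 * J x := by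
        refine setIntegral_mono_on (Integrable.mono hFi (hFm n) (Eventually.of_forall (hχ1 n)))
          (hJi.const_mul 24).integrableOn hSm fun x hx => ?_
        have hx0 : x 0 ≤ 0 := hx
        have h := mul_le_mul_of_nonneg_left
          (rpow_mul_le_currentOf (φ := φ) hp1 hp5 (t := t) (x := x) (by linarith))
          (coneCutoff_nonneg n (t, x))
        simp only [hF, hJ]
        linarith
    _ ≤ ∫ x, 24 * J x :=
        setIntegral_le_integral (hJi.const_mul 24)
          (Eventually.of_forall fun x => mul_nonneg (by norm_num) (hJ0 x))
    _ = 24 * ∫ x, J x := integral_const_mul _ _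
    _ ≤ 192 * E02R p (φ 0) (pt φ 0) := by
        have h1 := integral_coneCutoff_mul_le hp1 hp5 hΦ (wave_fderiv hΦ hφ) n ht
        have h2 := integral_coneCutoff_mul_zero_le hp1 hp5 hΦ hE n
        linarith
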